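/- Polynomially bounded ancient bicaloric functions on ℝⁿ are polynomials (Proposition 3.9): Let n ≥ 1 and k, ℓ > 0, and let u ∈ 𝒫_{k,ℓ}(ℝⁿ). Then u is a polynomial in the space variables and in t; that is, there is a real polynomial P in n+1 variables such that u(x,t) = P(x,t) for all x ∈ ℝⁿ and t ≤ 0. -/

import Mathlib

open Set Metric MeasureTheory

noncomputable section

/-- The Euclidean Laplacian of `f : ℝⁿ → ℝ`. -/
def lapE (n : ℕ) (f : EuclideanSpace ℝ (Fin n) → ℝ) (x : EuclideanSpace ℝ (Fin n)) : ℝ :=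
  ∑ i : Fin n, fderiv ℝ (fun y => fderiv ℝ f y (EuclideanSpace.single i 1)) x
    (EuclideanSpace.single i 1)

/-- The squared Hilbert–Schmidt norm of the Hessian of `f : ℝⁿ → ℝ`. -/
def hessNormSq (n : ℕ) (f : EuclideanSpace ℝ (Fin n) → ℝ) (x : EuclideanSpace ℝ (Fin n)) : ℝ :=
  ∑ i : Fin n, ∑ j : Fin n,
    (fderiv ℝ (fun y => fderiv ℝ f y (EuclideanSpace.single j 1)) x
      (EuclideanSpace.single i 1)) ^ 2

/-- The spatial Laplacian of `u : ℝⁿ × ℝ → ℝ`. -/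
def slap (n : ℕ) (u : EuclideanSpace ℝ (Fin n) × ℝ → ℝ) :
    EuclideanSpace ℝ (Fin n) × ℝ → ℝ :=
  fun z => lapE n (fun y => u (y, z.2)) z.1

/-- The time derivative of `u : ℝⁿ × ℝ → ℝ`. -/
def tderiv (n : ℕ) (u : EuclideanSpace ℝ (Fin n) × ℝ → ℝ) :
    EuclideanSpace ℝ (Fin n) × ℝ → ℝ :=
  fun z => deriv (fun s => u (z.1, s)) z.2

/-- The spatial gradient of `u : ℝⁿ × ℝ → ℝ`. -/
def sgrad (n : ℕ) (u : EuclideanSpace ℝ (Fin n) × ℝ → ℝ) :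
    EuclideanSpace ℝ (Fin n) × ℝ → EuclideanSpace ℝ (Fin n) :=
  fun z => gradient (fun y => u (y, z.2)) z.1

/-- The squared Hilbert–Schmidt norm of the spatial Hessian of `u : ℝⁿ × ℝ → ℝ`. -/
def shessNormSq (n : ℕ) (u : EuclideanSpace ℝ (Fin n) × ℝ → ℝ) :
    EuclideanSpace ℝ (Fin n) × ℝ → ℝ :=
  fun z => hessNormSq n (fun y => u (y, z.2)) z.1

/-- The heat ball `Q_r(p) = B_r(p) × [-r⁴, 0]`. -/
def heatBall (n : ℕ) (p : EuclideanSpace ℝ (Fin n)) (r : ℝ) :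
    Set (EuclideanSpace ℝ (Fin n) × ℝ) :=
  Metric.ball p r ×ˢ Set.Icc (-(r ^ 4)) 0

/-- `u` solves the biharmonic heat equation `∂ₜ u + ΔΔ u = 0` on `ℝⁿ × [-r⁴, 0]`. -/
def BicaloricOn (n : ℕ) (u : EuclideanSpace ℝ (Fin n) × ℝ → ℝ) (r : ℝ) : Prop :=
  ∀ (x : EuclideanSpace ℝ (Fin n)), ∀ t ∈ Set.Icc (-(r ^ 4)) (0 : ℝ),
    tderiv n u (x, t) + slap n (slap n u) (x, t) = 0

/-- `u ∈ 𝒫_{d,d'}(ℝⁿ)`: a smooth ancient solution of the biharmonic heat equation with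
`sup_{Q_R(p)} |u| ≤ C (1+R)^d` and `sup_{Q_R(p)} |∇u| ≤ C' (1+R)^{d'}`. -/
def PolyCaloric (n : ℕ) (d d' : ℝ) (u : EuclideanSpace ℝ (Fin n) × ℝ → ℝ) : Prop :=
  ContDiff ℝ (⊤ : ℕ∞) u ∧
  (∀ (x : EuclideanSpace ℝ (Fin n)), ∀ t ≤ (0 : ℝ),
    tderiv n u (x, t) + slap n (slap n u) (x, t) = 0) ∧
  (∃ C : ℝ, 0 < C ∧ ∀ (p : EuclideanSpace ℝ (Fin n)) (R : ℝ), 0 < R →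
    ∀ z ∈ heatBall n p R, |u z| ≤ C * (1 + R) ^ d) ∧
  (∃ C' : ℝ, 0 < C' ∧ ∀ (p : EuclideanSpace ℝ (Fin n)) (R : ℝ), 0 < R →
    ∀ z ∈ heatBall n p R, ‖sgrad n u z‖ ≤ C' * (1 + R) ^ d')

/-- `u ∈ ℋ_{d,d'}(ℝⁿ)`: a smooth biharmonic function with `sup_{B_R(p)} |u| ≤ C (1+R)^d`
and `sup_{B_R(p)} |∇u| ≤ C' (1+R)^{d'}`. -/
def PolyBiharmonic (n : ℕ) (d d' : ℝ) (u : EuclideanSpace ℝ (Fin n) → ℝ) : Prop :=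
  ContDiff ℝ (⊤ : ℕ∞) u ∧
  (∀ x, lapE n (lapE n u) x = 0) ∧
  (∃ C : ℝ, 0 < C ∧ ∀ (p : EuclideanSpace ℝ (Fin n)) (R : ℝ), 0 < R →
    ∀ x ∈ Metric.ball p R, |u x| ≤ C * (1 + R) ^ d) ∧
  (∃ C' : ℝ, 0 < C' ∧ ∀ (p : EuclideanSpace ℝ (Fin n)) (R : ℝ), 0 < R →
    ∀ x ∈ Metric.ball p R, ‖gradient u x‖ ≤ C' * (1 + R) ^ d')

/-- The set `𝒫_{d,d'}(ℝⁿ)`. -/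
def Pset (n : ℕ) (d d' : ℝ) : Set (EuclideanSpace ℝ (Fin n) × ℝ → ℝ) :=
  {u | PolyCaloric n d d' u}

/-- The set `ℋ_{d,d'}(ℝⁿ)`. -/
def Hset (n : ℕ) (d d' : ℝ) : Set (EuclideanSpace ℝ (Fin n) → ℝ) :=
  {u | PolyBiharmonic n d d' u}


open scoped ContDiff

/-- Directional derivative. -/
def DD {F : Type*} [NormedAddCommGroup F] [NormedSpace ℝ F] (e : F) (f : F → ℝ) : F → ℝ :=
  fun z => fderiv ℝ f z e

section DDlemmas
variable {F : Type*} [NormedAddCommGroup F] [NormedSpace ℝ F]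

theorem DD_contDiff (e : F) {f : F → ℝ} (hf : ContDiff ℝ ∞ f) : ContDiff ℝ ∞ (DD e f) := by
  have : ContDiff ℝ ∞ (fderiv ℝ f) := hf.fderiv_right (by simp)
  exact this.clm_apply contDiff_const

theorem sm_diff {f : F → ℝ} (hf : ContDiff ℝ ∞ f) (x : F) : DifferentiableAt ℝ f x :=
  (hf.differentiable (by simp)).differentiableAt

theorem DD_comm (e e' : F) {f : F → ℝ} (hf : ContDiff ℝ ∞ f) :
    DD e (DD e' f) = DD e' (DD e f) := by
  have h1 : ContDiff ℝ ∞ (fderiv ℝ f) := hf.fderiv_right (by simp)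
  have key : ∀ (a b : F) x, DD a (DD b f) x = fderiv ℝ (fderiv ℝ f) x a b := by
    intro a b x
    have : HasFDerivAt (fun y => fderiv ℝ f y b) _ x :=
      ((h1.differentiable (by simp)).differentiableAt (x := x)).hasFDerivAt.clm_apply
        (hasFDerivAt_const b x)
    unfold DD
    rw [this.fderiv]
    simp
  funext x
  rw [key, key]
  exact (hf.contDiffAt.isSymmSndFDerivAt (by simpa using ENat.LEInfty.out)) e e'

theorem DD_mul (e : F) {f g : F → ℝ} (hf : ContDiff ℝ ∞ f) (hg : ContDiff ℝ ∞ g) :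
    DD e (fun x => f x * g x) = fun x => f x * DD e g x + DD e f x * g x := by
  funext x
  unfold DD
  rw [fderiv_fun_mul (sm_diff hf x) (sm_diff hg x)]
  simp
  ring

theorem DD_add (e : F) {f g : F → ℝ} (hf : ContDiff ℝ ∞ f) (hg : ContDiff ℝ ∞ g) :
    DD e (fun x => f x + g x) = fun x => DD e f x + DD e g x := by
  funext x
  unfold DD
  rw [fderiv_fun_add (sm_diff hf x) (sm_diff hg x)]
  simp

theorem DD_sum (e : F) {ι : Type*} (s : Finset ι) {f : ι → F → ℝ}
    (hf : ∀ i, ContDiff ℝ ∞ (f i)) :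
    DD e (fun x => ∑ i ∈ s, f i x) = fun x => ∑ i ∈ s, DD e (f i) x := by
  funext x
  unfold DD
  rw [fderiv_fun_sum (fun i _ => sm_diff (hf i) x)]
  simp

theorem DD_pow (e : F) {f : F → ℝ} (hf : ContDiff ℝ ∞ f) (m : ℕ) :
    DD e (fun x => f x ^ (m + 1)) = fun x => (m + 1) * f x ^ m * DD e f x := by
  funext x
  unfold DD
  rw [fderiv_fun_pow _ (sm_diff hf x)]
  simp

theorem DD_const_mul (e : F) {f : F → ℝ} (hf : ContDiff ℝ ∞ f) (c : ℝ) :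
    DD e (fun x => c * f x) = fun x => c * DD e f x := by
  funext x
  unfold DD
  rw [fderiv_const_mul (sm_diff hf x)]
  simp

theorem DD_supp (e : F) {f : F → ℝ} (hf : HasCompactSupport f) : HasCompactSupport (DD e f) := by
  have := hf.fderiv (𝕜 := ℝ)
  exact this.comp_left (g := fun L : F →L[ℝ] ℝ => L e) (by simp)

theorem DD_zero_of_not_mem (e : F) {f : F → ℝ} {x : F} (hx : x ∉ tsupport f) : DD e f x = 0 := by
  unfold DD
  rw [fderiv_of_notMem_tsupport (𝕜 := ℝ) hx]; simp

end DDlemmas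

/-- Standard basis vector. -/
abbrev ee {n : ℕ} (i : Fin n) : EuclideanSpace ℝ (Fin n) := EuclideanSpace.single i 1

section spatial
variable {n : ℕ}

theorem lapE_eq (f : EuclideanSpace ℝ (Fin n) → ℝ) :
    lapE n f = fun x => ∑ i, DD (ee i) (DD (ee i) f) x := rfl

theorem lapE_contDiff {f : EuclideanSpace ℝ (Fin n) → ℝ} (hf : ContDiff ℝ ∞ f) :
    ContDiff ℝ ∞ (lapE n f) := by
  rw [lapE_eq]
  exact ContDiff.sum fun i _ => DD_contDiff _ (DD_contDiff _ hf)

theorem ibp (e : EuclideanSpace ℝ (Fin n)) {f g : EuclideanSpace ℝ (Fin n) → ℝ}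
    (hf : ContDiff ℝ ∞ f) (hg : ContDiff ℝ ∞ g) (hc : HasCompactSupport f) :
    ∫ x, f x * DD e g x = - ∫ x, DD e f x * g x := by
  have c1 := (DD_contDiff e hf).continuous
  have c2 := (DD_contDiff e hg).continuous
  have c3 := hf.continuous
  have c4 := hg.continuous
  refine integral_mul_fderiv_eq_neg_fderiv_mul_of_integrable ?_ ?_ ?_
    (fun x _ => sm_diff hf x) (fun x _ => sm_diff hg x)
  · exact (c1.mul c4).integrable_of_hasCompactSupport ((DD_supp e hc).mul_right)
  · exact (c3.mul c2).integrable_of_hasCompactSupport (hc.mul_right)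
  · exact (c3.mul c4).integrable_of_hasCompactSupport (hc.mul_right)

theorem ibp_lap {f g : EuclideanSpace ℝ (Fin n) → ℝ}
    (hf : ContDiff ℝ ∞ f) (hg : ContDiff ℝ ∞ g) (hc : HasCompactSupport f) :
    ∫ x, f x * lapE n g x = ∫ x, lapE n f x * g x := by
  simp only [lapE_eq, Finset.mul_sum, Finset.sum_mul]
  rw [integral_finsetSum, integral_finsetSum]
  · refine Finset.sum_congr rfl fun i _ => ?_
    rw [ibp _ hf (DD_contDiff _ hg) hc,
      ibp _ (DD_contDiff _ hf) hg (DD_supp _ hc), neg_neg]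
  · intro i _
    exact ((DD_contDiff _ (DD_contDiff _ hf)).continuous.mul hg.continuous
      ).integrable_of_hasCompactSupport ((DD_supp _ (DD_supp _ hc)).mul_right)
  · intro i _
    exact (hf.continuous.mul (DD_contDiff _ (DD_contDiff _ hg)).continuous
      ).integrable_of_hasCompactSupport (hc.mul_right)

theorem lap_mul {f w : EuclideanSpace ℝ (Fin n) → ℝ}
    (hf : ContDiff ℝ ∞ f) (hw : ContDiff ℝ ∞ w) (x : EuclideanSpace ℝ (Fin n)) :
    lapE n (fun x => f x * w x) x = f x * lapE n w x + 2 * ∑ i, DD (ee i) f x * DD (ee i) w x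
      + lapE n f x * w x := by
  simp only [lapE_eq, Finset.mul_sum, Finset.sum_mul]
  rw [← Finset.sum_add_distrib, ← Finset.sum_add_distrib]
  refine Finset.sum_congr rfl fun i _ => ?_
  have h1 := DD_contDiff (ee i) hf
  have h2 := DD_contDiff (ee i) hw
  rw [DD_mul _ hf hw, DD_add _ (hf.mul h2) (h1.mul hw), DD_mul _ hf h2, DD_mul _ h1 hw]
  ring

theorem lap_pow4 {φ : EuclideanSpace ℝ (Fin n) → ℝ}
    (hφ : ContDiff ℝ ∞ φ) (x : EuclideanSpace ℝ (Fin n)) :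
    lapE n (fun x => φ x ^ 4) x = 4 * φ x ^ 3 * lapE n φ x
      + 12 * φ x ^ 2 * ∑ i, DD (ee i) φ x ^ 2 := by
  simp only [lapE_eq, Finset.mul_sum]
  rw [← Finset.sum_add_distrib]
  refine Finset.sum_congr rfl fun i _ => ?_
  have h1 := DD_contDiff (ee i) hφ
  rw [DD_pow _ hφ 3, DD_mul _ (contDiff_const.mul (hφ.pow 3)) h1, DD_const_mul _ (hφ.pow 3),
    DD_pow _ hφ 2]
  push_cast
  ring

theorem pw_ineq (a f L G s p q r φ : ℝ) (hs : s ^ 2 ≤ a ^ 2 * G) (hp0 : 0 ≤ p) (hp : p ≤ a ^ 2)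
    (hq : |q| ≤ a ^ 2) (h0 : 0 ≤ φ) (h1 : φ ≤ 1) (hr : r = 8 * φ * q + 24 * p + 130 * a ^ 2) :
    - 2 * L ^ 2 - 16 * L * s - L * f * r - 129 * a ^ 2 * G - 260 * a ^ 2 * f * s
      ≤ 30022 * a ^ 4 * f ^ 2 := by
  have hr' : |r| ≤ 162 * a ^ 2 := by
    have hq' := abs_le.mp hq
    have : |φ * q| ≤ a ^ 2 := by
      rw [abs_mul, abs_of_nonneg h0]
      nlinarith [abs_nonneg q]
    have h3 := abs_le.mp this
    rw [hr, abs_le]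
    constructor <;> nlinarith
  have hr2 : r ^ 2 ≤ (162 * a ^ 2) ^ 2 := sq_le_sq' (abs_le.mp hr').1 (abs_le.mp hr').2
  have hrf : r ^ 2 * f ^ 2 ≤ (162 * a ^ 2) ^ 2 * f ^ 2 :=
    mul_le_mul_of_nonneg_right hr2 (sq_nonneg f)
  nlinarith [sq_nonneg (L + 16 * s), sq_nonneg (L + f * r), sq_nonneg (s + 130 * a ^ 2 * f)]

theorem spatial_ineq {f φ χ : EuclideanSpace ℝ (Fin n) → ℝ} {a : ℝ}
    (hf : ContDiff ℝ ∞ f) (hφ : ContDiff ℝ ∞ φ) (hφc : HasCompactSupport φ)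
    (hχ : Continuous χ) (hχc : HasCompactSupport χ) (h0 : ∀ x, 0 ≤ φ x) (h1 : ∀ x, φ x ≤ 1)
    (hD : ∀ x, ∑ i, DD (ee i) φ x ^ 2 ≤ a ^ 2) (hL : ∀ x, |lapE n φ x| ≤ a ^ 2)
    (hone : ∀ x ∈ tsupport φ, χ x = 1) :
    a ^ 2 * (∫ x, (∑ i, DD (ee i) f x ^ 2) * φ x ^ 2)
      - 2 * (∫ x, f x * φ x ^ 4 * lapE n (lapE n f) x) ≤
    30022 * a ^ 4 * ∫ x, f x ^ 2 * χ x ^ 2 := by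
  have hφ4 : ContDiff ℝ ∞ (fun x => φ x ^ 4) := hφ.pow 4
  have hφ2 : ContDiff ℝ ∞ (fun x => φ x ^ 2) := hφ.pow 2
  have hLf := lapE_contDiff hf
  have cD : ∀ i, Continuous (DD (ee i) f) := fun i => (DD_contDiff _ hf).continuous
  have cDφ : ∀ i, Continuous (DD (ee i) φ) := fun i => (DD_contDiff _ hφ).continuous
  have cφ := hφ.continuous
  have cf := hf.continuous
  have cLf := hLf.continuous
  have cLφ := (lapE_contDiff hφ).continuous
  have sφ2 : HasCompactSupport (fun x => φ x ^ 2) :=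
    hφc.comp_left (g := fun y : ℝ => y ^ 2) (by simp)
  have sφ4 : HasCompactSupport (fun x => φ x ^ 4) :=
    hφc.comp_left (g := fun y : ℝ => y ^ 4) (by simp)
  have sχ2 : HasCompactSupport (fun x => χ x ^ 2) :=
    hχc.comp_left (g := fun y : ℝ => y ^ 2) (by simp)
  -- first identity
  have id1 : ∫ x, f x * φ x ^ 4 * lapE n (lapE n f) x =
      ∫ x, φ x ^ 2 * (lapE n f x * (f x * (4 * φ x * lapE n φ x
      + 12 * ∑ i, DD (ee i) φ x ^ 2) + 8 * φ x * (∑ i, DD (ee i) f x * DD (ee i) φ x) +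
        lapE n f x * φ x ^ 2)) := by
    rw [ibp_lap (f := fun x => f x * φ x ^ 4) (hf.mul hφ4) hLf (sφ4.mul_left)]
    congr 1
    funext x
    rw [lap_mul hf hφ4, lap_pow4 hφ]
    have : ∑ i, DD (ee i) f x * DD (ee i) (fun x => φ x ^ 4) x
        = 4 * φ x ^ 3 * ∑ i, DD (ee i) f x * DD (ee i) φ x := by
      rw [Finset.mul_sum]
      refine Finset.sum_congr rfl fun i _ => ?_
      rw [DD_pow _ hφ 3]
      push_cast
      ring
    rw [this]
    ring
  -- second identity
  have id2 : ∫ x, φ x ^ 2 * (f x * lapE n f x + (∑ i, DD (ee i) f x ^ 2)) +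
      2 * (f x * φ x * (∑ i, DD (ee i) f x * DD (ee i) φ x)) = 0 := by
    have hfφ : ContDiff ℝ ∞ (fun x => f x * φ x ^ 2) := hf.mul hφ2
    have sfφ : HasCompactSupport (fun x => f x * φ x ^ 2) := sφ2.mul_left
    have : ∀ x, φ x ^ 2 * (f x * lapE n f x + (∑ i, DD (ee i) f x ^ 2)) +
      2 * (f x * φ x * (∑ i, DD (ee i) f x * DD (ee i) φ x)) =
      ∑ i, ((f x * φ x ^ 2) * DD (ee i) (DD (ee i) f) x +
        DD (ee i) (fun x => f x * φ x ^ 2) x * DD (ee i) f x) := by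
      intro x
      have h2 : ∀ i : Fin n, DD (ee i) (fun x => f x * φ x ^ 2) x =
          f x * (2 * φ x * DD (ee i) φ x) + DD (ee i) f x * φ x ^ 2 := by
        intro i
        rw [DD_mul _ hf hφ2, DD_pow _ hφ 1]
        push_cast
        ring
      simp only [h2, lapE_eq, mul_add, Finset.mul_sum]
      rw [← Finset.sum_add_distrib, ← Finset.sum_add_distrib]
      refine Finset.sum_congr rfl fun i _ => ?_
      ring
    simp only [this]
    have i1 : ∀ i : Fin n, Integrable (fun x => (f x * φ x ^ 2) * DD (ee i) (DD (ee i) f) x) :=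
      fun i => (hfφ.continuous.mul
        (DD_contDiff _ (DD_contDiff _ hf)).continuous).integrable_of_hasCompactSupport
        sfφ.mul_right
    have i2 : ∀ i : Fin n, Integrable
        (fun x => DD (ee i) (fun x => f x * φ x ^ 2) x * DD (ee i) f x) :=
      fun i => ((DD_contDiff _ hfφ).continuous.mul (cD i)).integrable_of_hasCompactSupport
        (DD_supp _ sfφ).mul_right
    rw [integral_finsetSum _ (fun i _ => (i1 i).fun_add (i2 i))]
    refine Finset.sum_eq_zero fun i _ => ?_
    rw [integral_add (i1 i) (i2 i), ibp _ hfφ (DD_contDiff _ hf) sfφ]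
    ring
  have cS : Continuous (fun x => ∑ i, DD (ee i) f x * DD (ee i) φ x) :=
    continuous_finsetSum _ fun i _ => (cD i).mul (cDφ i)
  have cG : Continuous (fun x => ∑ i, DD (ee i) f x ^ 2) :=
    continuous_finsetSum _ fun i _ => (cD i).pow 2
  have cP : Continuous (fun x => ∑ i, DD (ee i) φ x ^ 2) :=
    continuous_finsetSum _ fun i _ => (cDφ i).pow 2
  have intA : Integrable (fun x => (∑ i, DD (ee i) f x ^ 2) * φ x ^ 2) :=
    (cG.mul (cφ.pow 2)).integrable_of_hasCompactSupport sφ2.mul_left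
  have intB : Integrable (fun x => φ x ^ 2 * (lapE n f x * (f x * (4 * φ x * lapE n φ x
      + 12 * ∑ i, DD (ee i) φ x ^ 2) + 8 * φ x * (∑ i, DD (ee i) f x * DD (ee i) φ x) +
        lapE n f x * φ x ^ 2))) :=
    Continuous.integrable_of_hasCompactSupport (by fun_prop) sφ2.mul_right
  have intC : Integrable (fun x => φ x ^ 2 * (f x * lapE n f x + (∑ i, DD (ee i) f x ^ 2)) +
      2 * (f x * φ x * (∑ i, DD (ee i) f x * DD (ee i) φ x))) := by
    refine Continuous.integrable_of_hasCompactSupport (by fun_prop) ?_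
    exact HasCompactSupport.add sφ2.mul_right
      (HasCompactSupport.mul_left (HasCompactSupport.mul_right (HasCompactSupport.mul_left hφc)))
  have intR : Integrable (fun x => f x ^ 2 * χ x ^ 2) :=
    ((cf.pow 2).mul (hχ.pow 2)).integrable_of_hasCompactSupport sχ2.mul_left
  rw [id1]
  have hsplit : ∀ I J : ℝ, a ^ 2 * I - 2 * J = a ^ 2 * I - 2 * J - 130 * a ^ 2 * 0 := by
    intros; ring
  rw [hsplit, ← id2, ← integral_const_mul, ← integral_const_mul, ← integral_const_mul,
    ← integral_const_mul, ← integral_sub (intA.const_mul _) (intB.const_mul _),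
    ← integral_sub ((intA.const_mul _).sub' (intB.const_mul _)) (intC.const_mul _)]
  refine integral_mono (((intA.const_mul _).sub (intB.const_mul _)).sub (intC.const_mul _))
    (intR.const_mul _) ?_
  intro x
  by_cases hx : x ∈ tsupport φ
  · have hχ1 := hone x hx
    have hs : (φ x * ∑ i, DD (ee i) f x * DD (ee i) φ x) ^ 2 ≤
        a ^ 2 * (φ x ^ 2 * ∑ i, DD (ee i) f x ^ 2) := by
      have cs := Finset.sum_mul_sq_le_sq_mul_sq Finset.univ
        (fun i : Fin n => DD (ee i) f x) (fun i => DD (ee i) φ x)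
      have hG : 0 ≤ ∑ i : Fin n, DD (ee i) f x ^ 2 := Finset.sum_nonneg fun i _ => sq_nonneg _
      have h3 := cs.trans (mul_le_mul_of_nonneg_left (hD x) hG)
      have h4 := mul_le_mul_of_nonneg_left h3 (sq_nonneg (φ x))
      calc _ = φ x ^ 2 * (∑ i, DD (ee i) f x * DD (ee i) φ x) ^ 2 := by ring
        _ ≤ _ := h4
        _ = _ := by ring
    have := pw_ineq a (f x) (φ x ^ 2 * lapE n f x) _ _ (∑ i, DD (ee i) φ x ^ 2) (lapE n φ x) _
      (φ x) hs (Finset.sum_nonneg fun i _ => sq_nonneg _) (hD x) (hL x) (h0 x) (h1 x) rfl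
    simp only [hχ1]
    refine le_trans (le_of_eq ?_) (this.trans (le_of_eq ?_)) <;> ring
  · have hφ0 : φ x = 0 := image_eq_zero_of_notMem_tsupport hx
    simp only [hφ0]
    have : 0 ≤ 30022 * a ^ 4 * (f x ^ 2 * χ x ^ 2) := by positivity
    simpa using this

end spatial

section timepart
variable {n : ℕ}


theorem slice_smooth {v : (EuclideanSpace ℝ (Fin n)) × ℝ → ℝ} (hv : ContDiff ℝ ∞ v) (t : ℝ) :
    ContDiff ℝ ∞ (fun y => v (y, t)) :=
  hv.comp (contDiff_id.prodMk contDiff_const)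

theorem slice_DD (e : (EuclideanSpace ℝ (Fin n))) {v : (EuclideanSpace ℝ (Fin n)) × ℝ → ℝ} (hv : ContDiff ℝ ∞ v) (t : ℝ) :
    DD e (fun y => v (y, t)) = fun y => DD (e, (0 : ℝ)) v (y, t) := by
  funext y
  have h1 : HasFDerivAt (fun y : (EuclideanSpace ℝ (Fin n)) => (y, t)) (ContinuousLinearMap.inl ℝ (EuclideanSpace ℝ (Fin n)) ℝ) y :=
    hasFDerivAt_prodMk_left y t
  have h2 := (sm_diff hv (y, t)).hasFDerivAt.comp y h1
  unfold DD
  have h3 : fderiv ℝ (fun y => v (y, t)) y = _ := h2.fderiv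
  rw [h3]
  simp

theorem time_deriv {v : (EuclideanSpace ℝ (Fin n)) × ℝ → ℝ} (hv : ContDiff ℝ ∞ v) (x : (EuclideanSpace ℝ (Fin n))) (t : ℝ) :
    HasDerivAt (fun s => v (x, s)) (DD ((0 : (EuclideanSpace ℝ (Fin n))), (1 : ℝ)) v (x, t)) t := by
  have h1 : HasFDerivAt (fun s : ℝ => (x, s)) (ContinuousLinearMap.inr ℝ (EuclideanSpace ℝ (Fin n)) ℝ) t :=
    hasFDerivAt_prodMk_right x t
  have h2 := ((sm_diff hv (x, t)).hasFDerivAt.comp t h1).hasDerivAt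
  have h3 : HasDerivAt (fun s => v (x, s)) _ t := h2
  convert h3 using 1
  simp [DD]

/-- Spatial Laplacian for functions on space-time. -/
def LL (v : (EuclideanSpace ℝ (Fin n)) × ℝ → ℝ) : (EuclideanSpace ℝ (Fin n)) × ℝ → ℝ :=
  fun z => ∑ i, DD (ee i, (0 : ℝ)) (DD (ee i, (0 : ℝ)) v) z

theorem LL_smooth {v : (EuclideanSpace ℝ (Fin n)) × ℝ → ℝ} (hv : ContDiff ℝ ∞ v) : ContDiff ℝ ∞ (LL v) :=
  ContDiff.sum fun _ _ => DD_contDiff _ (DD_contDiff _ hv)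

theorem lapE_slice {v : (EuclideanSpace ℝ (Fin n)) × ℝ → ℝ} (hv : ContDiff ℝ ∞ v) (t : ℝ) :
    lapE n (fun y => v (y, t)) = fun y => LL v (y, t) := by
  rw [lapE_eq]
  funext x
  unfold LL
  refine Finset.sum_congr rfl fun i _ => ?_
  rw [slice_DD _ hv, slice_DD _ (DD_contDiff _ hv)]

theorem slap_eq {v : (EuclideanSpace ℝ (Fin n)) × ℝ → ℝ} (hv : ContDiff ℝ ∞ v) : slap n v = LL v := by
  funext z
  unfold slap
  rw [lapE_slice hv]

/-- Bicaloric on the lower half-space. -/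
def Bical (v : (EuclideanSpace ℝ (Fin n)) × ℝ → ℝ) : Prop :=
  ∀ (x : (EuclideanSpace ℝ (Fin n))) (t : ℝ), t ≤ 0 → DD ((0 : (EuclideanSpace ℝ (Fin n))), (1 : ℝ)) v (x, t) + LL (LL v) (x, t) = 0

theorem LL_comm (e : (EuclideanSpace ℝ (Fin n)) × ℝ) {v : (EuclideanSpace ℝ (Fin n)) × ℝ → ℝ} (hv : ContDiff ℝ ∞ v) :
    LL (DD e v) = DD e (LL v) := by
  unfold LL
  rw [DD_sum _ _ (fun i => DD_contDiff _ (DD_contDiff _ hv))]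
  funext z
  refine Finset.sum_congr rfl fun i _ => ?_
  rw [DD_comm _ e hv, DD_comm _ e (DD_contDiff _ hv)]

theorem Bical_DD (e : (EuclideanSpace ℝ (Fin n))) {v : (EuclideanSpace ℝ (Fin n)) × ℝ → ℝ} (hv : ContDiff ℝ ∞ v) (hb : Bical v) :
    Bical (DD (e, (0 : ℝ)) v) := by
  intro x t ht
  rw [LL_comm _ hv, LL_comm _ (LL_smooth hv), DD_comm _ _ hv]
  have s1 := DD_contDiff ((0 : (EuclideanSpace ℝ (Fin n))), (1 : ℝ)) hv
  have s2 := LL_smooth (LL_smooth hv)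
  have h := DD_add (e, (0 : ℝ)) s1 s2
  have h' := congrFun h (x, t)
  rw [← h', ← congrFun (slice_DD e (s1.add s2) t) x]
  have : (fun y => DD ((0 : (EuclideanSpace ℝ (Fin n))), (1 : ℝ)) v (y, t) + LL (LL v) (y, t)) = fun _ => 0 := by
    funext y
    exact hb y t ht
  unfold DD at this ⊢
  rw [this]
  simp

theorem cont_int {w : (EuclideanSpace ℝ (Fin n)) × ℝ → ℝ} (hw : Continuous w) {ψ : (EuclideanSpace ℝ (Fin n)) → ℝ} (hψ : Continuous ψ)
    (hc : HasCompactSupport ψ) : Continuous (fun t => ∫ x, w (x, t) * ψ x) := by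
  have : ∀ t, ∫ x, w (x, t) * ψ x = ∫ x in tsupport ψ, w (x, t) * ψ x := by
    intro t
    rw [setIntegral_eq_integral_of_forall_compl_eq_zero]
    intro x hx
    rw [image_eq_zero_of_notMem_tsupport hx, mul_zero]
  simp only [this]
  apply continuous_parametric_integral_of_continuous _ hc
  unfold Function.uncurry
  fun_prop

theorem deriv_int {w : (EuclideanSpace ℝ (Fin n)) × ℝ → ℝ} (hw : ContDiff ℝ ∞ w) {ψ : (EuclideanSpace ℝ (Fin n)) → ℝ} (hψ : Continuous ψ)
    (hc : HasCompactSupport ψ) (t : ℝ) :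
    HasDerivAt (fun t => ∫ x, w (x, t) * ψ x)
      (∫ x, DD ((0 : (EuclideanSpace ℝ (Fin n))), (1 : ℝ)) w (x, t) * ψ x) t := by
  have cw := hw.continuous
  have cD := (DD_contDiff ((0 : (EuclideanSpace ℝ (Fin n))), (1 : ℝ)) hw).continuous
  have hK : IsCompact (tsupport ψ ×ˢ Metric.closedBall t 1) :=
    IsCompact.prod hc (isCompact_closedBall t 1)
  obtain ⟨C, hC⟩ := hK.exists_bound_of_continuousOn cD.continuousOn
  refine (hasDerivAt_integral_of_dominated_loc_of_deriv_le (bound := fun x => C * |ψ x|)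
    (F := fun t x => w (x, t) * ψ x)
    (F' := fun t x => DD ((0 : (EuclideanSpace ℝ (Fin n))), (1 : ℝ)) w (x, t) * ψ x)
    (Metric.closedBall_mem_nhds t one_pos) ?_ ?_ ?_ ?_ ?_ ?_).2
  · exact Filter.Eventually.of_forall fun s => Continuous.aestronglyMeasurable (by fun_prop)
  · exact Continuous.integrable_of_hasCompactSupport (by fun_prop) hc.mul_left
  · exact Continuous.aestronglyMeasurable (by fun_prop)
  · refine Filter.Eventually.of_forall fun x s hs => ?_
    by_cases hx : x ∈ tsupport ψ
    · rw [norm_mul, Real.norm_eq_abs (ψ x)]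
      exact mul_le_mul_of_nonneg_right (hC (x, s) ⟨hx, hs⟩) (abs_nonneg _)
    · simp [image_eq_zero_of_notMem_tsupport hx]
  · exact Continuous.integrable_of_hasCompactSupport (by fun_prop)
      (HasCompactSupport.mul_left (hc.comp_left (g := fun y : ℝ => |y|) (by simp)))
  · exact Filter.Eventually.of_forall fun x s hs => (time_deriv hw x s).mul_const _

theorem cacc {v : (EuclideanSpace ℝ (Fin n)) × ℝ → ℝ} (hv : ContDiff ℝ ∞ v) (hb : Bical v) {φ χ : (EuclideanSpace ℝ (Fin n)) → ℝ} {a : ℝ}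
    (hφ : ContDiff ℝ ∞ φ) (hφc : HasCompactSupport φ)
    (hχ : Continuous χ) (hχc : HasCompactSupport χ) (h0 : ∀ x, 0 ≤ φ x) (h1 : ∀ x, φ x ≤ 1)
    (hD : ∀ x, ∑ i, DD (ee i) φ x ^ 2 ≤ a ^ 2) (hL : ∀ x, |lapE n φ x| ≤ a ^ 2)
    (hone : ∀ x ∈ tsupport φ, χ x = 1) {S T : ℝ} (hS : 0 ≤ S) (hST : S ≤ T) (i : Fin n) :
    a ^ 2 * (T - S) * (∫ t in (-S)..0, ∫ x, DD (ee i, (0 : ℝ)) v (x, t) ^ 2 * φ x ^ 2)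
      ≤ (30022 * a ^ 4 * T + 1) * ∫ t in (-T)..0, ∫ x, v (x, t) ^ 2 * χ x ^ 2 := by
  have sφ2 : HasCompactSupport (fun x => φ x ^ 2) :=
    hφc.comp_left (g := fun y : ℝ => y ^ 2) (by simp)
  have sφ4 : HasCompactSupport (fun x => φ x ^ 4) :=
    hφc.comp_left (g := fun y : ℝ => y ^ 4) (by simp)
  have sχ2 : HasCompactSupport (fun x => χ x ^ 2) :=
    hχc.comp_left (g := fun y : ℝ => y ^ 2) (by simp)
  have cφ := hφ.continuous
  have cv := hv.continuous
  have hv2 : ContDiff ℝ ∞ (fun z => v z ^ 2) := hv.pow 2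
  have sDi := DD_contDiff (ee i, (0 : ℝ)) hv
  have cDi := sDi.continuous
  have cDv : ∀ j : Fin n, Continuous (DD (ee j, (0 : ℝ)) v) :=
    fun j => (DD_contDiff _ hv).continuous
  set E : ℝ → ℝ := fun t => ∫ x, v (x, t) ^ 2 * φ x ^ 4 with hE
  set E' : ℝ → ℝ := fun t => ∫ x, DD ((0 : (EuclideanSpace ℝ (Fin n))), (1 : ℝ)) (fun z => v z ^ 2) (x, t) * φ x ^ 4 with hE'
  set H : ℝ → ℝ := fun t => ∫ x, v (x, t) ^ 2 * χ x ^ 2 with hH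
  set K : ℝ → ℝ := fun t => ∫ x, DD (ee i, (0 : ℝ)) v (x, t) ^ 2 * φ x ^ 2 with hK
  have dE : ∀ t, HasDerivAt E (E' t) t := fun t => deriv_int hv2 (cφ.pow 4) sφ4 t
  have cE' : Continuous E' := cont_int (DD_contDiff _ hv2).continuous (cφ.pow 4) sφ4
  have cE : Continuous E := cont_int (cv.pow 2) (cφ.pow 4) sφ4
  have cH : Continuous H := cont_int (cv.pow 2) (hχ.pow 2) sχ2
  have cK : Continuous K := cont_int (cDi.pow 2) (cφ.pow 2) sφ2
  have K0 : ∀ t, 0 ≤ K t := fun t => integral_nonneg fun x => by positivity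
  have E0 : ∀ t, 0 ≤ E t := fun t => integral_nonneg fun x => by positivity
  have H0 : ∀ t, 0 ≤ H t := fun t => integral_nonneg fun x => by positivity
  have EH : ∀ t, E t ≤ H t := by
    intro t
    refine integral_mono ?_ ?_ ?_
    · exact Continuous.integrable_of_hasCompactSupport (by fun_prop) sφ4.mul_left
    · exact Continuous.integrable_of_hasCompactSupport (by fun_prop) sχ2.mul_left
    · intro x
      by_cases hx : x ∈ tsupport φ
      · simp only [hone x hx]
        exact mul_le_mul_of_nonneg_left (by
          simpa using pow_le_one₀ (n := 4) (h0 x) (h1 x)) (sq_nonneg _)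
      · simp only [image_eq_zero_of_notMem_tsupport hx]
        simp
        positivity
  have key : ∀ t, t ≤ 0 → E' t + a ^ 2 * K t ≤ 30022 * a ^ 4 * H t := by
    intro t ht
    have hs := spatial_ineq (slice_smooth hv t) hφ hφc hχ hχc h0 h1 hD hL hone
    have e1 : E' t = - (2 * ∫ x, v (x, t) * φ x ^ 4 * lapE n (lapE n fun y => v (y, t)) x) := by
      rw [← integral_const_mul, ← integral_neg]
      refine integral_congr_ae (Filter.Eventually.of_forall fun x => ?_)
      simp only
      have := hb x t ht
      rw [DD_pow _ hv 1, lapE_slice hv, lapE_slice (LL_smooth hv)]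
      beta_reduce
      rw [show DD ((0 : (EuclideanSpace ℝ (Fin n))), (1 : ℝ)) v (x, t) = - LL (LL v) (x, t) by linarith]
      push_cast
      ring
    have e2 : K t ≤ ∫ x, (∑ j, DD (ee j) (fun y => v (y, t)) x ^ 2) * φ x ^ 2 := by
      have hc : ∀ j : Fin n, Continuous (DD (ee j) (fun y => v (y, t))) :=
        fun j => (DD_contDiff _ (slice_smooth hv t)).continuous
      refine integral_mono ?_ ?_ ?_
      · exact Continuous.integrable_of_hasCompactSupport (by fun_prop) sφ2.mul_left
      · exact Continuous.integrable_of_hasCompactSupport (by fun_prop) sφ2.mul_left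
      · intro x
        refine mul_le_mul_of_nonneg_right ?_ (sq_nonneg _)
        rw [← congrFun (slice_DD (ee i) hv t) x]
        exact Finset.single_le_sum (f := fun j => DD (ee j) (fun y => v (y, t)) x ^ 2)
          (fun j _ => sq_nonneg _) (Finset.mem_univ i)
    have e3 := mul_le_mul_of_nonneg_left e2 (sq_nonneg a)
    rw [e1]
    linarith
  have hT : 0 ≤ T := hS.trans hST
  have parts : ∫ t in (-T)..0, (t + T) * E' t = T * E 0 - ∫ t in (-T)..0, E t := by
    have := intervalIntegral.integral_mul_deriv_eq_deriv_mul (a := -T) (b := 0)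
      (u := fun t => t + T) (v := E) (u' := fun _ => 1) (v' := E')
      (fun x _ => (hasDerivAt_id x).add_const T) (fun x _ => dE x)
      (by simp) (cE'.intervalIntegrable _ _)
    simpa using this
  have ii : ∀ {g : ℝ → ℝ} (_ : Continuous g) (b c : ℝ), IntervalIntegrable g volume b c :=
    fun hg b c => hg.intervalIntegrable b c
  have m1 : ∫ t in (-T)..0, (a ^ 2 * ((t + T) * K t)) ≤
      ∫ t in (-T)..0, (30022 * a ^ 4 * T * H t - (t + T) * E' t) := by
    refine intervalIntegral.integral_mono_on (by linarith) (ii (by fun_prop) _ _)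
      (ii (by fun_prop) _ _) ?_
    intro t ht
    have k1 := mul_le_mul_of_nonneg_left (key t ht.2) (show 0 ≤ t + T by linarith [ht.1])
    have k2 : (t + T) * (30022 * a ^ 4 * H t) ≤ T * (30022 * a ^ 4 * H t) :=
      mul_le_mul_of_nonneg_right (by linarith [ht.2]) (by have := H0 t; positivity)
    nlinarith
  rw [intervalIntegral.integral_sub (ii (by fun_prop) _ _) (ii (by fun_prop) _ _), parts,
    intervalIntegral.integral_const_mul, intervalIntegral.integral_const_mul] at m1
  have m2 : ∫ t in (-T)..0, E t ≤ ∫ t in (-T)..0, H t :=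
    intervalIntegral.integral_mono_on (by linarith) (ii cE _ _) (ii cH _ _) fun t _ => EH t
  have m3 : (T - S) * ∫ t in (-S)..0, K t ≤ ∫ t in (-T)..0, (t + T) * K t := by
    rw [← intervalIntegral.integral_add_adjacent_intervals (a := -T) (b := -S) (c := 0)
      (ii (by fun_prop) _ _) (ii (by fun_prop) _ _), ← intervalIntegral.integral_const_mul]
    have p1 : 0 ≤ ∫ t in (-T)..(-S), (t + T) * K t :=
      intervalIntegral.integral_nonneg (by linarith) fun t ht =>
        mul_nonneg (by linarith [ht.1]) (K0 t)
    have p2 : ∫ t in (-S)..0, (T - S) * K t ≤ ∫ t in (-S)..0, (t + T) * K t :=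
      intervalIntegral.integral_mono_on (by linarith) (ii (by fun_prop) _ _)
        (ii (by fun_prop) _ _) fun t ht =>
        mul_le_mul_of_nonneg_right (by linarith [ht.1]) (K0 t)
    linarith
  have m4 := mul_le_mul_of_nonneg_left m3 (sq_nonneg a)
  have m5 := mul_nonneg hT (E0 0)
  linarith

end timepart

section conclusion
variable {n : ℕ}

theorem exists_cutoffs (n : ℕ) : ∃ (c B : ℝ) (φ : ℝ → EuclideanSpace ℝ (Fin n) → ℝ), 0 < c ∧ 0 ≤ B ∧
    ∀ R : ℝ, 0 < R → ContDiff ℝ ∞ (φ R) ∧ HasCompactSupport (φ R) ∧ (∀ x, 0 ≤ φ R x) ∧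
      (∀ x, φ R x ≤ 1) ∧ (∀ x, ‖x‖ ≤ R → φ R x = 1) ∧ (∀ x ∈ tsupport (φ R), ‖x‖ ≤ 2 * R) ∧
      (∀ x, ∑ i, DD (ee i) (φ R) x ^ 2 ≤ (c / R) ^ 2) ∧
      (∀ x, |lapE n (φ R) x| ≤ (c / R) ^ 2) ∧ (∫ x, φ R x ^ 2) = R ^ n * B := by
  let η : ContDiffBump (0 : EuclideanSpace ℝ (Fin n)) := ⟨1, 2, one_pos, one_lt_two⟩
  have hη : ContDiff ℝ ∞ (η : EuclideanSpace ℝ (Fin n) → ℝ) := η.contDiff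
  have hηc : HasCompactSupport (η : EuclideanSpace ℝ (Fin n) → ℝ) := η.hasCompactSupport
  have hts : tsupport (η : EuclideanSpace ℝ (Fin n) → ℝ) = Metric.closedBall 0 2 := η.tsupport_eq
  have b1 : ∃ C, ∀ x, ‖∑ i, DD (ee i) η x ^ 2‖ ≤ C := by
    refine Continuous.bounded_above_of_compact_support
      (continuous_finsetSum _ fun i _ => ((DD_contDiff _ hη).continuous).pow 2) ?_
    refine HasCompactSupport.intro (K := tsupport η) hηc fun x hx => ?_
    exact Finset.sum_eq_zero fun i _ => by rw [DD_zero_of_not_mem _ hx]; simp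
  have b2 : ∃ C, ∀ x, ‖lapE n η x‖ ≤ C := by
    refine Continuous.bounded_above_of_compact_support (lapE_contDiff hη).continuous ?_
    refine HasCompactSupport.intro (K := tsupport η) hηc fun x hx => ?_
    rw [lapE_eq]
    refine Finset.sum_eq_zero fun i _ => ?_
    refine DD_zero_of_not_mem _ fun h => hx ?_
    exact tsupport_fderiv_apply_subset ℝ _ h
  obtain ⟨C1, hC1⟩ := b1
  obtain ⟨C2, hC2⟩ := b2
  set c := 1 + |C1| + |C2| with hc
  have a1 := abs_nonneg C1
  have a2 := abs_nonneg C2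
  have a3 := le_abs_self C1
  have a4 := le_abs_self C2
  have hc1 : C1 ≤ c ^ 2 := by nlinarith
  have hc2 : C2 ≤ c ^ 2 := by nlinarith
  have hcp : 0 < c := by positivity
  refine ⟨c, ∫ x, η x ^ 2, fun R x => η (R⁻¹ • x), hcp,
    integral_nonneg fun x => sq_nonneg _, fun R hR => ?_⟩
  have hsm : ∀ {g : EuclideanSpace ℝ (Fin n) → ℝ}, ContDiff ℝ ∞ g →
      ContDiff ℝ ∞ (fun x => g (R⁻¹ • x)) := fun hg => hg.comp (contDiff_const_smul _)
  have hDD : ∀ (e : EuclideanSpace ℝ (Fin n)) {g : EuclideanSpace ℝ (Fin n) → ℝ}, ContDiff ℝ ∞ g →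
      DD e (fun x => g (R⁻¹ • x)) = fun x => R⁻¹ * DD e g (R⁻¹ • x) := by
    intro e g hg
    funext x
    have h1 : HasFDerivAt (fun x : EuclideanSpace ℝ (Fin n) => R⁻¹ • x)
      (R⁻¹ • ContinuousLinearMap.id ℝ (EuclideanSpace ℝ (Fin n))) x := (hasFDerivAt_id x).const_smul R⁻¹
    have h2 := (sm_diff hg (R⁻¹ • x)).hasFDerivAt.comp x h1
    have h3 : fderiv ℝ (fun x => g (R⁻¹ • x)) x = _ := h2.fderiv
    unfold DD
    rw [h3]
    simp
  have hn : ∀ x : EuclideanSpace ℝ (Fin n), ‖R⁻¹ • x‖ = ‖x‖ / R := by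
    intro x
    rw [norm_smul, norm_inv, Real.norm_eq_abs, abs_of_pos hR]; ring
  have hsup : ∀ x, ¬ ‖x‖ ≤ 2 * R → η (R⁻¹ • x) = 0 := by
    intro x hx
    apply image_eq_zero_of_notMem_tsupport
    rw [hts, mem_closedBall_zero_iff, hn, div_le_iff₀ hR]
    exact hx
  refine ⟨hsm hη, ?_, fun x => η.nonneg, fun x => η.le_one, ?_, ?_, ?_, ?_, ?_⟩
  · refine HasCompactSupport.intro (isCompact_closedBall (0 : EuclideanSpace ℝ (Fin n)) (2 * R)) ?_
    intro x hx
    exact hsup x (by simpa using hx)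
  · intro x hx
    apply η.one_of_mem_closedBall
    rw [mem_closedBall_zero_iff, hn, div_le_iff₀ hR]
    simpa [η] using hx
  · intro x hx
    have : tsupport (fun x => η (R⁻¹ • x)) ⊆ Metric.closedBall 0 (2 * R) := by
      refine closure_minimal ?_ Metric.isClosed_closedBall
      intro y hy
      by_contra h
      exact hy (hsup y (by simpa using h))
    simpa using this hx
  · intro x
    simp only [hDD _ hη, mul_pow, ← Finset.mul_sum]
    rw [div_eq_inv_mul, mul_pow]
    refine mul_le_mul_of_nonneg_left ?_ (by positivity)
    exact (le_abs_self _).trans ((hC1 _).trans hc1)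
  · intro x
    rw [lapE_eq]
    have : ∀ i : Fin n, DD (ee i) (DD (ee i) fun x => η (R⁻¹ • x)) x =
        R⁻¹ ^ 2 * DD (ee i) (DD (ee i) η) (R⁻¹ • x) := by
      intro i
      rw [hDD _ hη, DD_const_mul _ (hsm (DD_contDiff _ hη)), hDD _ (DD_contDiff _ hη)]
      ring
    simp only [this, ← Finset.mul_sum]
    rw [div_eq_inv_mul, mul_pow, abs_mul, abs_of_nonneg (by positivity : 0 ≤ R⁻¹ ^ 2)]
    refine mul_le_mul_of_nonneg_left ?_ (by positivity)
    exact (hC2 _).trans hc2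
  · have := Measure.integral_comp_inv_smul_of_nonneg volume
      (fun x : EuclideanSpace ℝ (Fin n) => η x ^ 2) hR.le
    simpa using this

theorem antideriv_exists (Q : Polynomial ℝ) : ∃ P : Polynomial ℝ, P.derivative = Q := by
  induction Q using Polynomial.induction_on' with
  | add p q hp hq =>
    obtain ⟨P, rfl⟩ := hp
    obtain ⟨P', rfl⟩ := hq
    exact ⟨P + P', by simp⟩
  | monomial k a =>
    refine ⟨Polynomial.monomial (k + 1) (a / (k + 1)), ?_⟩
    rw [Polynomial.derivative_monomial]
    have : (k : ℝ) + 1 ≠ 0 := by positivity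
    simp [this]

theorem poly_of_deriv (m : ℕ) : ∀ (f : ℕ → ℝ → ℝ), (∀ j s, HasDerivAt (f j) (f (j + 1) s) s) →
    (∀ s, f m s = 0) → ∃ P : Polynomial ℝ, ∀ s, f 0 s = P.eval s := by
  induction m with
  | zero => exact fun f _ h => ⟨0, by simpa using h⟩
  | succ m ih =>
    intro f hf h0
    obtain ⟨Q, hQ⟩ := ih (fun j => f (j + 1)) (fun j s => hf (j + 1) s) h0
    obtain ⟨P, rfl⟩ := antideriv_exists Q
    have hd : ∀ s, HasDerivAt (fun s => f 0 s - P.eval s) 0 s := by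
      intro s
      have h := (hf 0 s).sub (P.hasDerivAt s)
      have e : f (0 + 1) s - P.derivative.eval s = 0 := by rw [hQ]; simp
      rw [e] at h
      exact h
    have hc := is_const_of_deriv_eq_zero (fun s => (hd s).differentiableAt)
      (fun s => (hd s).deriv)
    refine ⟨P + Polynomial.C (f 0 0 - P.eval 0), fun s => ?_⟩
    have := hc s 0
    simp only [Polynomial.eval_add, Polynomial.eval_C]
    linarith

theorem deriv_zero_of_bdd (m : ℕ) (f : ℕ → ℝ → ℝ) (hf : ∀ j s, HasDerivAt (f j) (f (j + 1) s) s)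
    (h0 : ∀ s, f m s = 0) (C : ℝ) (hC : ∀ s, |f 0 s| ≤ C) (s : ℝ) : f 1 s = 0 := by
  obtain ⟨P, hP⟩ := poly_of_deriv m f hf h0
  have hb : P.degree ≤ 0 := by
    rw [← Polynomial.isBoundedUnder_abs_atTop_iff]
    refine ⟨C, ?_⟩
    simp only [Filter.eventually_map]
    exact Filter.Eventually.of_forall fun s => by rw [← hP]; exact hC s
  have hfc : f 0 = fun _ => P.coeff 0 := by
    funext s
    rw [hP, Polynomial.eq_C_of_degree_le_zero hb]
    simp
  have h := hf 0 s
  rw [hfc] at h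
  exact h.unique (hasDerivAt_const s _)


/-- Localized space-time energy. -/
def Phi (φ : ℝ → (EuclideanSpace ℝ (Fin n)) → ℝ) (v : (EuclideanSpace ℝ (Fin n)) × ℝ → ℝ) (R : ℝ) : ℝ :=
  ∫ t in (-(R ^ 4))..0, ∫ x, v (x, t) ^ 2 * φ R x ^ 2

theorem Phi_nonneg (φ : ℝ → (EuclideanSpace ℝ (Fin n)) → ℝ) (v : (EuclideanSpace ℝ (Fin n)) × ℝ → ℝ) (R : ℝ) : 0 ≤ Phi φ v R :=
  intervalIntegral.integral_nonneg (by have : 0 ≤ R ^ 4 := by positivity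
                                       linarith) fun t _ =>
    integral_nonneg fun x => by positivity

theorem line_deriv {v : (EuclideanSpace ℝ (Fin n)) × ℝ → ℝ} (hv : ContDiff ℝ ∞ v) (e x : (EuclideanSpace ℝ (Fin n))) (t s : ℝ) :
    HasDerivAt (fun s : ℝ => v (x + s • e, t)) (DD (e, (0 : ℝ)) v (x + s • e, t)) s := by
  have h1 : HasDerivAt (fun s : ℝ => x + s • e) e s := by
    simpa using ((hasDerivAt_id s).smul_const e).const_add x
  have h2 : HasDerivAt (fun s : ℝ => (x + s • e, t)) (e, (0 : ℝ)) s :=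
    h1.prodMk (hasDerivAt_const s t)
  exact (sm_diff hv (x + s • e, t)).hasFDerivAt.comp_hasDerivAt s h2

theorem DD_zero_half {w : (EuclideanSpace ℝ (Fin n)) × ℝ → ℝ} (hw : ContDiff ℝ ∞ w) (h : ∀ x t, t ≤ 0 → w (x, t) = 0)
    (e x : (EuclideanSpace ℝ (Fin n))) (t : ℝ) (ht : t ≤ 0) : DD (e, (0 : ℝ)) w (x, t) = 0 := by
  have h1 := line_deriv hw e x t 0
  have h2 : (fun s : ℝ => w (x + s • e, t)) = fun _ => 0 := by
    funext s; exact h _ _ ht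
  rw [h2] at h1
  simpa using h1.unique (hasDerivAt_const (0 : ℝ) (0 : ℝ))

theorem iter_smooth (e : (EuclideanSpace ℝ (Fin n)) × ℝ) {v : (EuclideanSpace ℝ (Fin n)) × ℝ → ℝ} (hv : ContDiff ℝ ∞ v) (m : ℕ) :
    ContDiff ℝ ∞ ((DD e)^[m] v) := by
  induction m with
  | zero => simpa using hv
  | succ m ih => rw [Function.iterate_succ_apply']; exact DD_contDiff _ ih

theorem iter_bical (e : (EuclideanSpace ℝ (Fin n))) {v : (EuclideanSpace ℝ (Fin n)) × ℝ → ℝ} (hv : ContDiff ℝ ∞ v) (hb : Bical v) (m : ℕ) :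
    Bical ((DD (e, (0 : ℝ)))^[m] v) := by
  induction m with
  | zero => simpa using hb
  | succ m ih => rw [Function.iterate_succ_apply']; exact Bical_DD _ (iter_smooth _ hv m) ih

theorem vanish {u : (EuclideanSpace ℝ (Fin n)) × ℝ → ℝ} (hu : ContDiff ℝ ∞ u) (hb : Bical u) (C : ℝ) (K : ℕ)
    (hC : ∀ R : ℝ, 1 ≤ R → ∀ x t, ‖x‖ ≤ 2 * R → -(R ^ 4) ≤ t → t ≤ 0 → u (x, t) ^ 2 ≤ C * R ^ K)
    (i : Fin n) : ∃ m : ℕ, ∀ x t, t ≤ 0 → (DD (ee i, (0 : ℝ)))^[m] u (x, t) = 0 := by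
  obtain ⟨c, B, φ, hc, hB, hφ⟩ := exists_cutoffs n
  -- one Caccioppoli step
  have step : ∃ M : ℝ, 0 ≤ M ∧ ∀ v : (EuclideanSpace ℝ (Fin n)) × ℝ → ℝ, ContDiff ℝ ∞ v → Bical v → ∀ R : ℝ, 1 ≤ R →
      R ^ 2 * Phi φ (DD (ee i, (0 : ℝ)) v) R ≤ M * Phi φ v (2 * R) := by
    refine ⟨(30022 * 16 * c ^ 4 + 1) / (15 * c ^ 2), by positivity, ?_⟩
    intro v hv hbv R hR
    have hR0 : 0 < R := by linarith
    obtain ⟨s1, s2, s3, s4, s5, s6, s7, s8, s9⟩ := hφ R hR0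
    obtain ⟨r1, r2, r3, r4, r5, r6, r7, r8, r9⟩ := hφ (2 * R) (by linarith)
    have hR4 : 0 ≤ R ^ 4 := by positivity
    have key := cacc hv hbv s1 s2 r1.continuous r2 s3 s4 s7 s8 (fun x hx => r5 x (s6 x hx))
      (S := R ^ 4) (T := (2 * R) ^ 4) hR4 (by nlinarith) i
    have e1 : (c / R) ^ 2 * ((2 * R) ^ 4 - R ^ 4) = 15 * c ^ 2 * R ^ 2 := by
      field_simp; ring
    have e2 : 30022 * (c / R) ^ 4 * (2 * R) ^ 4 = 30022 * 16 * c ^ 4 := by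
      field_simp; ring
    rw [e1, e2] at key
    change 15 * c ^ 2 * R ^ 2 * Phi φ (DD (ee i, (0 : ℝ)) v) R ≤
      (30022 * 16 * c ^ 4 + 1) * Phi φ v (2 * R) at key
    rw [div_mul_eq_mul_div, le_div_iff₀ (by positivity)]
    linarith
  obtain ⟨M, hM, step⟩ := step
  -- initial growth
  have base : ∀ R : ℝ, 1 ≤ R → Phi φ u R ≤ C * B * R ^ (K + n + 4) := by
    intro R hR
    have hR0 : 0 < R := by linarith
    obtain ⟨s1, s2, s3, s4, s5, s6, s7, s8, s9⟩ := hφ R hR0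
    have sφ2 : HasCompactSupport (fun x => φ R x ^ 2) :=
      s2.comp_left (g := fun y : ℝ => y ^ 2) (by simp)
    have cφ := s1.continuous
    have cu := hu.continuous
    have hR4 : 0 ≤ R ^ 4 := by positivity
    have hin : ∀ t ∈ Set.Icc (-(R ^ 4)) 0, ∫ x, u (x, t) ^ 2 * φ R x ^ 2 ≤
        C * R ^ K * (R ^ n * B) := by
      intro t ht
      rw [← s9, ← integral_const_mul]
      refine integral_mono ?_ ?_ ?_
      · exact Continuous.integrable_of_hasCompactSupport (by fun_prop) sφ2.mul_left
      · exact Continuous.integrable_of_hasCompactSupport (by fun_prop) sφ2.mul_left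
      · intro x
        by_cases hx : x ∈ tsupport (φ R)
        · exact mul_le_mul_of_nonneg_right (hC R hR x t (s6 x hx) ht.1 ht.2) (sq_nonneg _)
        · simp [image_eq_zero_of_notMem_tsupport hx]
    have := intervalIntegral.integral_mono_on (a := -(R ^ 4)) (b := 0) (by linarith)
      ((cont_int (cu.pow 2) (cφ.pow 2) sφ2).intervalIntegrable _ _)
      (intervalIntegrable_const (μ := volume)) hin
    refine this.trans (le_of_eq ?_)
    simp
    ring
  set N := K + n + 4 with hN
  -- iteration
  have iter : ∀ m : ℕ, ∃ A : ℝ, ∀ R : ℝ, 1 ≤ R →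
      R ^ (2 * m) * Phi φ ((DD (ee i, (0 : ℝ)))^[m] u) R ≤ A * R ^ N := by
    intro m
    induction m with
    | zero => exact ⟨C * B, by simpa using base⟩
    | succ m ih =>
      obtain ⟨A, hA⟩ := ih
      refine ⟨M * A * 2 ^ N, fun R hR => ?_⟩
      have hR0 : 0 < R := by linarith
      rw [Function.iterate_succ_apply']
      set v := (DD (ee i, (0 : ℝ)))^[m] u with hv
      have st := step v (iter_smooth _ hu m) (iter_bical _ hu hb m) R hR
      have h2 := hA (2 * R) (by linarith)
      have P0 := Phi_nonneg φ v (2 * R)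
      have hp : R ^ (2 * m) ≤ (2 * R) ^ (2 * m) := pow_le_pow_left₀ hR0.le (by linarith) _
      calc R ^ (2 * (m + 1)) * Phi φ (DD (ee i, (0 : ℝ)) v) R
          = R ^ (2 * m) * (R ^ 2 * Phi φ (DD (ee i, (0 : ℝ)) v) R) := by ring
        _ ≤ R ^ (2 * m) * (M * Phi φ v (2 * R)) := mul_le_mul_of_nonneg_left st (by positivity)
        _ = M * (R ^ (2 * m) * Phi φ v (2 * R)) := by ring
        _ ≤ M * ((2 * R) ^ (2 * m) * Phi φ v (2 * R)) :=
          mul_le_mul_of_nonneg_left (mul_le_mul_of_nonneg_right hp P0) hM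
        _ ≤ M * (A * (2 * R) ^ N) := mul_le_mul_of_nonneg_left h2 hM
        _ = M * A * 2 ^ N * R ^ N := by ring
  obtain ⟨A, hA⟩ := iter (N + 1)
  refine ⟨N + 1, ?_⟩
  set v := (DD (ee i, (0 : ℝ)))^[N + 1] u with hv
  have vs : ContDiff ℝ ∞ v := iter_smooth _ hu _
  have cv := vs.continuous
  have decay : ∀ R : ℝ, 1 ≤ R → R * Phi φ v R ≤ A := by
    intro R hR
    have hR0 : 0 < R := by linarith
    have h := hA R hR
    have P0 := Phi_nonneg φ v R
    have hp : R ^ N * R ≤ R ^ (2 * (N + 1)) := by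
      rw [← pow_succ]; exact pow_le_pow_right₀ hR (by omega)
    have h2 := (mul_le_mul_of_nonneg_right hp P0).trans h
    have h3 : R ^ N * (R * Phi φ v R) ≤ R ^ N * A := by linarith
    exact le_of_mul_le_mul_left h3 (by positivity)
  have cI : ∀ R : ℝ, 0 < R → Continuous (fun t => ∫ x, v (x, t) ^ 2 * φ R x ^ 2) := by
    intro R hR
    obtain ⟨s1, s2, -⟩ := hφ R hR
    exact cont_int (cv.pow 2) (s1.continuous.pow 2)
      (s2.comp_left (g := fun y : ℝ => y ^ 2) (by simp))
  have mono : ∀ S R : ℝ, 1 ≤ S → 2 * S ≤ R → Phi φ v S ≤ Phi φ v R := by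
    intro S R hS hR
    obtain ⟨s1, s2, s3, s4, s5, s6, -⟩ := hφ S (by linarith)
    obtain ⟨r1, r2, r3, r4, r5, r6, -⟩ := hφ R (by linarith)
    have c1 := s1.continuous
    have c2 := r1.continuous
    have hSR : S ^ 4 ≤ R ^ 4 := pow_le_pow_left₀ (by linarith) (by linarith) _
    have hS4 : 0 ≤ S ^ 4 := by positivity
    have i1 : Phi φ v S ≤ ∫ t in (-(S ^ 4))..0, ∫ x, v (x, t) ^ 2 * φ R x ^ 2 := by
      refine intervalIntegral.integral_mono_on (by linarith)
        ((cI S (by linarith)).intervalIntegrable _ _)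
        ((cI R (by linarith)).intervalIntegrable _ _) fun t _ => ?_
      refine integral_mono ?_ ?_ ?_
      · exact Continuous.integrable_of_hasCompactSupport (by fun_prop)
          (HasCompactSupport.mul_left (s2.comp_left (g := fun y : ℝ => y ^ 2) (by simp)))
      · exact Continuous.integrable_of_hasCompactSupport (by fun_prop)
          (HasCompactSupport.mul_left (r2.comp_left (g := fun y : ℝ => y ^ 2) (by simp)))
      · intro x
        by_cases hx : x ∈ tsupport (φ S)
        · simp only [r5 x ((s6 x hx).trans hR)]
          exact mul_le_mul_of_nonneg_left (by
            simpa using pow_le_one₀ (n := 2) (s3 x) (s4 x)) (sq_nonneg _)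
        · simp only [image_eq_zero_of_notMem_tsupport hx]
          simp
          positivity
    refine i1.trans ?_
    unfold Phi
    rw [← intervalIntegral.integral_add_adjacent_intervals (a := -(R ^ 4)) (b := -(S ^ 4)) (c := 0)
      ((cI R (by linarith)).intervalIntegrable _ _) ((cI R (by linarith)).intervalIntegrable _ _)]
    have : 0 ≤ ∫ t in (-(R ^ 4))..(-(S ^ 4)), ∫ x, v (x, t) ^ 2 * φ R x ^ 2 :=
      intervalIntegral.integral_nonneg (by linarith) fun t _ =>
        integral_nonneg fun x => by positivity
    linarith
  have zero : ∀ S : ℝ, 1 ≤ S → Phi φ v S ≤ 0 := by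
    intro S hS
    by_contra hpos
    push Not at hpos
    set R := max (2 * S) ((A + 1) / Phi φ v S) with hRdef
    have hR1 : 2 * S ≤ R := le_max_left _ _
    have hR2 : (A + 1) / Phi φ v S ≤ R := le_max_right _ _
    have h1 := mono S R hS hR1
    have h2 := decay R (by linarith)
    rw [div_le_iff₀ hpos] at hR2
    have h3 := mul_le_mul_of_nonneg_left h1 (show 0 ≤ R by linarith)
    linarith
  intro x t ht
  by_contra hne
  set S := 1 + ‖x‖ + |t| with hS
  have hx0 := norm_nonneg x
  have ht0 := abs_nonneg t
  have hS1 : 1 ≤ S := by linarith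
  have hS4 : S ≤ S ^ 4 := by
    calc S = S ^ 1 := by ring
      _ ≤ S ^ 4 := pow_le_pow_right₀ hS1 (by norm_num)
  obtain ⟨s1, s2, s3, s4, s5, s6, -⟩ := hφ S (by linarith)
  have c1 := s1.continuous
  have hpos : 0 < ∫ y, v (y, t) ^ 2 * φ S y ^ 2 := by
    refine Continuous.integral_pos_of_hasCompactSupport_nonneg_nonzero (x := x) (by fun_prop)
      (HasCompactSupport.mul_left (s2.comp_left (g := fun y : ℝ => y ^ 2) (by simp)))
      (fun y => by positivity) ?_
    rw [s5 x (by linarith)]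
    simpa using hne
  have : 0 < Phi φ v S := by
    refine intervalIntegral.integral_pos (by linarith) (cI S (by linarith)).continuousOn
      (fun t _ => integral_nonneg fun x => by positivity) ⟨t, ⟨?_, ht⟩, hpos⟩
    rw [abs_of_nonpos ht] at hS
    linarith
  exact absurd (zero S hS1) (not_le.mpr this)

end conclusion

/-- **Polynomially bounded ancient bicaloric functions on ℝⁿ are polynomials**
(Proposition 3.9): there is a real polynomial `P` in the `n+1` variables `t, x_1, …, x_n`
(variable `0` is `t`) with `u(x,t) = P(t, x)` for all `x` and all `t ≤ 0`. -/
theorem bicaloric_is_polynomial (n : ℕ) (hn : 1 ≤ n) (k ℓ : ℝ) (hk : 0 < k) (hℓ : 0 < ℓ)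
    (u : EuclideanSpace ℝ (Fin n) × ℝ → ℝ) (hu : PolyCaloric n k ℓ u) :
    ∃ P : MvPolynomial (Fin (n + 1)) ℝ,
      ∀ (x : EuclideanSpace ℝ (Fin n)), ∀ t ≤ (0 : ℝ),
        u (x, t) = MvPolynomial.eval (Fin.cons t (fun j => x j)) P := by
  obtain ⟨hs, heq, ⟨C, hC0, hC⟩, -⟩ := hu
  have hs : ContDiff ℝ ∞ u := hs
  have hb : Bical u := by
    intro x t ht
    have := heq x t ht
    rw [slap_eq hs, slap_eq (LL_smooth hs)] at this
    unfold tderiv at this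
    rw [(time_deriv hs x t).deriv] at this
    exact this
  have growth : ∀ R : ℝ, 1 ≤ R → ∀ (x : EuclideanSpace ℝ (Fin n)) (t : ℝ), ‖x‖ ≤ 2 * R →
      -(R ^ 4) ≤ t → t ≤ 0 → u (x, t) ^ 2 ≤ C ^ 2 * 4 ^ (2 * ⌈k⌉₊) * R ^ (2 * ⌈k⌉₊) := by
    intro R hR x t hx ht ht0
    have h1 := hC 0 (3 * R) (by linarith) (x, t) (by
      refine ⟨?_, ?_, ht0⟩
      · rw [mem_ball_zero_iff]; change ‖x‖ < 3 * R; linarith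
      · change -((3 * R) ^ 4) ≤ t
        have : 0 ≤ R ^ 4 := by positivity
        nlinarith)
    have h2 : (1 + 3 * R) ^ k ≤ (4 * R) ^ ⌈k⌉₊ := by
      calc (1 + 3 * R) ^ k ≤ (4 * R) ^ k :=
            Real.rpow_le_rpow (by linarith) (by linarith) hk.le
        _ ≤ (4 * R) ^ ((⌈k⌉₊ : ℕ) : ℝ) :=
            Real.rpow_le_rpow_of_exponent_le (by linarith) (Nat.le_ceil k)
        _ = _ := Real.rpow_natCast _ _
    have h3 := h1.trans (mul_le_mul_of_nonneg_left h2 hC0.le)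
    have h4 := pow_le_pow_left₀ (abs_nonneg _) h3 2
    rw [sq_abs] at h4
    refine h4.trans (le_of_eq ?_)
    rw [mul_pow, mul_pow, mul_pow]
    ring
  have hgrad : ∀ (i : Fin n) (x : EuclideanSpace ℝ (Fin n)) (t : ℝ), t ≤ 0 →
      DD (ee i, (0 : ℝ)) u (x, t) = 0 := by
    intro i x t ht
    obtain ⟨m, hm⟩ := vanish hs hb _ _ growth i
    have hbd : ∀ y : EuclideanSpace ℝ (Fin n), |u (y, t)| ≤ C * (1 + (1 + |t|)) ^ k := by
      intro y
      refine hC y (1 + |t|) (by positivity) (y, t) ⟨?_, ?_, ht⟩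
      · exact Metric.mem_ball_self (by positivity)
      · change -((1 + |t|) ^ 4) ≤ t
        have h1 : 1 + |t| ≤ (1 + |t|) ^ 4 := by
          calc 1 + |t| = (1 + |t|) ^ 1 := by ring
            _ ≤ _ := pow_le_pow_right₀ (by linarith [abs_nonneg t]) (by norm_num)
        linarith [neg_abs_le t]
    have := deriv_zero_of_bdd m
      (fun j s => (DD (ee i, (0 : ℝ)))^[j] u (x + s • ee i, t))
      (fun j s => by
        simp only [Function.iterate_succ_apply']
        exact line_deriv (iter_smooth _ hs j) (ee i) x t s)
      (fun s => hm _ _ ht) _ (fun s => hbd _) 0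
    simpa using this
  have hLL : ∀ {w : EuclideanSpace ℝ (Fin n) × ℝ → ℝ}, ContDiff ℝ ∞ w →
      (∀ (i : Fin n) x t, t ≤ 0 → DD (ee i, (0 : ℝ)) w (x, t) = 0) →
      ∀ x t, t ≤ 0 → LL w (x, t) = 0 := by
    intro w hw h x t ht
    exact Finset.sum_eq_zero fun i _ => DD_zero_half (DD_contDiff _ hw) (h i) _ _ _ ht
  have hL1 := hLL hs hgrad
  have hL2 := hLL (LL_smooth hs) fun i x t ht => DD_zero_half (LL_smooth hs) hL1 _ _ _ ht
  have hdt : ∀ x t, t ≤ 0 → DD ((0 : EuclideanSpace ℝ (Fin n)), (1 : ℝ)) u (x, t) = 0 := by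
    intro x t ht
    have := hb x t ht
    rw [hL2 x t ht] at this
    simpa using this
  have hx : ∀ x t, t ≤ 0 → u (x, t) = u (0, t) := by
    intro x t ht
    have hsl := slice_smooth hs t
    refine is_const_of_fderiv_eq_zero (𝕜 := ℝ) (hsl.differentiable (by simp)) (fun y => ?_) x 0
    have : ((fderiv ℝ (fun y => u (y, t)) y : EuclideanSpace ℝ (Fin n) →L[ℝ] ℝ) :
        EuclideanSpace ℝ (Fin n) →ₗ[ℝ] ℝ) = 0 := by
      refine (EuclideanSpace.basisFun (Fin n) ℝ).toBasis.ext fun i => ?_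
      have h1 := congrFun (slice_DD (ee i) hs t) y
      rw [hgrad i y t ht] at h1
      simpa [DD] using h1
    ext z
    exact congrArg (fun L : EuclideanSpace ℝ (Fin n) →ₗ[ℝ] ℝ => L z) this
  refine ⟨MvPolynomial.C (u (0, 0)), fun x t ht => ?_⟩
  rw [MvPolynomial.eval_C, hx x t ht]
  have hcst := constant_of_has_deriv_right_zero (a := t) (b := 0) (f := fun s => u (0, s))
    (Continuous.continuousOn (by have := hs.continuous; fun_prop))
    (fun s hs' => by
      have h := time_deriv hs 0 s
      rw [hdt 0 s hs'.2.le] at h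
      exact h.hasDerivWithinAt)
  exact (hcst 0 ⟨ht, le_rfl⟩).symm
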